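/- The perfectly correlated three-bit distribution P on {0,1} × {0,1} × {0,1}, defined by P(0,0,0) = P(1,1,1) = 1/2 and P = 0 elsewhere, does not admit a classical triangle model. -/

import Mathlib

open scoped Classical

noncomputable section

/-- `P` admits a classical triangle model: there are nonempty finite hidden-variable
sets `ΛAB`, `ΛBC`, `ΛAC` with probability distributions `qAB`, `qBC`, `qAC`, and
stochastic kernels `PA(a | λAB, λAC)`, `PB(b | λAB, λBC)`, `PC(c | λBC, λAC)`, such that
`P(a,b,c) = Σ qAB(λAB)·qBC(λBC)·qAC(λAC)·PA(a|λAB,λAC)·PB(b|λAB,λBC)·PC(c|λBC,λAC)`. -/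
def AdmitsTriangleModel {A B C : Type} [Fintype A] [Fintype B] [Fintype C]
    (P : A → B → C → ℝ) : Prop :=
  ∃ (ΛAB ΛBC ΛAC : Type) (_ : Fintype ΛAB) (_ : Fintype ΛBC) (_ : Fintype ΛAC),
    Nonempty ΛAB ∧ Nonempty ΛBC ∧ Nonempty ΛAC ∧
    ∃ (qAB : ΛAB → ℝ) (qBC : ΛBC → ℝ) (qAC : ΛAC → ℝ)
      (PA : ΛAB → ΛAC → A → ℝ) (PB : ΛAB → ΛBC → B → ℝ) (PC : ΛBC → ΛAC → C → ℝ),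
      (∀ l, 0 ≤ qAB l) ∧ (∑ l, qAB l) = 1 ∧
      (∀ l, 0 ≤ qBC l) ∧ (∑ l, qBC l) = 1 ∧
      (∀ l, 0 ≤ qAC l) ∧ (∑ l, qAC l) = 1 ∧
      (∀ lab lac a, 0 ≤ PA lab lac a) ∧ (∀ lab lac, (∑ a, PA lab lac a) = 1) ∧
      (∀ lab lbc b, 0 ≤ PB lab lbc b) ∧ (∀ lab lbc, (∑ b, PB lab lbc b) = 1) ∧
      (∀ lbc lac c, 0 ≤ PC lbc lac c) ∧ (∀ lbc lac, (∑ c, PC lbc lac c) = 1) ∧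
      ∀ a b c, P a b c =
        ∑ lab : ΛAB, ∑ lbc : ΛBC, ∑ lac : ΛAC,
          qAB lab * qBC lbc * qAC lac * PA lab lac a * PB lab lbc b * PC lbc lac c

/-- A probability distribution on a finite type is positive somewhere. -/
theorem exists_pos_of_sum_eq_one {ι : Type*} [Fintype ι] {f : ι → ℝ} (h0 : ∀ i, 0 ≤ f i)
    (h1 : ∑ i, f i = 1) : ∃ i, 0 < f i := by
  obtain ⟨i, -, hi⟩ := Finset.exists_ne_zero_of_sum_ne_zero (h1.trans_ne one_ne_zero)
  exact ⟨i, (h0 i).lt_of_ne' hi⟩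

/-- A triple sum of nonnegative reals is positive iff one of its terms is. -/
theorem sum_sum_sum_pos_iff {ι κ μ : Type*} [Fintype ι] [Fintype κ] [Fintype μ]
    {f : ι → κ → μ → ℝ} (h0 : ∀ i j k, 0 ≤ f i j k) :
    0 < ∑ i, ∑ j, ∑ k, f i j k ↔ ∃ i j k, 0 < f i j k := by
  have h2 (i j) : 0 ≤ ∑ k, f i j k := Finset.sum_nonneg fun k _ => h0 i j k
  have h1 (i) : 0 ≤ ∑ j, ∑ k, f i j k := Finset.sum_nonneg fun j _ => h2 i j
  rw [Finset.sum_pos_iff_of_nonneg fun i _ => h1 i]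
  simp only [Finset.sum_pos_iff_of_nonneg fun j _ => h2 _ j,
    Finset.sum_pos_iff_of_nonneg fun k _ => h0 _ _ k, Finset.mem_univ, true_and]

/-- The perfectly correlated three-bit distribution, with
`P(0,0,0) = P(1,1,1) = 1/2` and `P = 0` elsewhere, does not admit a classical triangle
model. -/
theorem stmt8 :
    ¬ AdmitsTriangleModel
        (fun a b c : Fin 2 => if a = b ∧ b = c then (1 : ℝ) / 2 else 0) := by
  rintro ⟨ΛAB, ΛBC, ΛAC, _, _, _, -, -, -, qAB, qBC, qAC, PA, PB, PC, hAB, -, hBC, -, hAC, -,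
    hPA, hPA1, hPB, hPB1, hPC, hPC1, hP⟩
  have pos_iff (a b c : Fin 2) : (a = b ∧ b = c) ↔ ∃ x y z, 0 < qAB x ∧ 0 < qBC y ∧ 0 < qAC z ∧
      0 < PA x z a ∧ 0 < PB x y b ∧ 0 < PC y z c := by
    have mul_pos_iff' {u v : ℝ} (hu : 0 ≤ u) (hv : 0 ≤ v) : 0 < u * v ↔ 0 < u ∧ 0 < v := by
      simp only [hu.lt_iff_ne', hv.lt_iff_ne', (mul_nonneg hu hv).lt_iff_ne', mul_ne_zero_iff]
    have hq x y z : 0 ≤ qAB x * qBC y * qAC z :=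
      mul_nonneg (mul_nonneg (hAB x) (hBC y)) (hAC z)
    have hqA x y z : 0 ≤ qAB x * qBC y * qAC z * PA x z a := mul_nonneg (hq x y z) (hPA x z a)
    have hqB x y z : 0 ≤ qAB x * qBC y * qAC z * PA x z a * PB x y b :=
      mul_nonneg (hqA x y z) (hPB x y b)
    have h : (a = b ∧ b = c) ↔ (0 : ℝ) < if a = b ∧ b = c then (1 : ℝ) / 2 else 0 := by
      split_ifs with h <;> simp [h]
    rw [h.trans (iff_of_eq (congrArg (0 < ·) (hP a b c))), sum_sum_sum_pos_iff fun x y z => mul_nonneg (hqB x y z) (hPC y z c)]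
    simp only [mul_pos_iff' (hqB _ _ _) (hPC _ _ _), mul_pos_iff' (hqA _ _ _) (hPB _ _ _),
      mul_pos_iff' (hq _ _ _) (hPA _ _ _), mul_pos_iff' (mul_nonneg (hAB _) (hBC _)) (hAC _),
      mul_pos_iff' (hAB _) (hBC _), and_assoc]
  obtain ⟨x, -, z, hx, -, hz, hA, -, -⟩ := (pos_iff 0 0 0).1 ⟨rfl, rfl⟩
  obtain ⟨-, y, z', -, hy, hz', -, -, hC⟩ := (pos_iff 1 1 1).1 ⟨rfl, rfl⟩
  obtain ⟨c, hc⟩ := exists_pos_of_sum_eq_one (hPC y z) (hPC1 y z)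
  obtain ⟨a, ha⟩ := exists_pos_of_sum_eq_one (hPA x z') (hPA1 x z')
  -- The middle output must agree with the first output of one run and the third of the other.
  obtain ⟨b, hb⟩ := exists_pos_of_sum_eq_one (hPB x y) (hPB1 x y)
  have h0 := (pos_iff 0 b c).2 ⟨x, y, z, hx, hy, hz, hA, hb, hc⟩
  have h1 := (pos_iff a b 1).2 ⟨x, y, z', hx, hy, hz', ha, hb, hC⟩
  exact zero_ne_one (h0.1.trans h1.2)
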